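/- Let p, q be coprime integers with q ≠ 0, let v = (q,p)/√(p²+q²), and consider the closed geodesic Σ of T² parametrized by t ↦ x₀ + t v for t ∈ [0, 2π√(p²+q²)]. There exists a constant C = C(p,q), depending only on p and q and independent of λ, such that for every λ ≥ 1, every x₀ ∈ ℝ², and every choice of complex coefficients (c_n)_{n∈E} with E = {n ∈ ℤ² : |n| = λ}, one has ∫₀^{2π√(p²+q²)} |Σ_{n∈E} c_n e^{i n·(x₀+tv)}|² dt ≤ C · Σ_{n∈E} |c_n|². -/

import Mathlib

open MeasureTheory

/-- Dot product of a lattice point `n ∈ ℤ^d` with a real vector `x ∈ ℝ^d`. -/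
noncomputable def dotIR {d : ℕ} (n : Fin d → ℤ) (x : Fin d → ℝ) : ℝ :=
  ∑ i, (n i : ℝ) * x i

theorem aux_int (k : ℤ) (L : ℝ) (hL : 0 < L) :
    (∫ t in (0 : ℝ)..(2 * Real.pi * L), Complex.exp (((k : ℂ) * Complex.I / L) * t))
      = if k = 0 then ((2 * Real.pi * L : ℝ) : ℂ) else 0 := by
  have hL' : (L : ℂ) ≠ 0 := by exact_mod_cast hL.ne'
  split_ifs with h
  · subst h; simp
  · have hk : (k : ℂ) ≠ 0 := by exact_mod_cast h
    rw [integral_exp_mul_complex (by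
      exact div_ne_zero (mul_ne_zero hk Complex.I_ne_zero) hL')]
    have : ((k : ℂ) * Complex.I / L) * ((2 * Real.pi * L : ℝ) : ℂ) = k * (2 * Real.pi * Complex.I) := by
      push_cast; field_simp
    rw [this, Complex.exp_int_mul_two_pi_mul_I]
    simp

theorem aux_main {ι : Type*} (E : Finset ι) (k : ι → ℤ) (a : ι → ℂ) (L : ℝ) (hL : 0 < L)
    (hcard : ∀ n ∈ E, (E.filter (fun m => k n = k m)).card ≤ 2) :
    (∫ t in (0 : ℝ)..(2 * Real.pi * L),
      ‖∑ n ∈ E, a n * Complex.exp (((k n : ℂ) * Complex.I / L) * t)‖ ^ 2)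
      ≤ (4 * Real.pi * L) * ∑ n ∈ E, ‖a n‖ ^ 2 := by
  have hT : 0 ≤ 2 * Real.pi * L := by positivity
  have h1 : ((∫ t in (0 : ℝ)..(2 * Real.pi * L),
      ‖∑ n ∈ E, a n * Complex.exp (((k n : ℂ) * Complex.I / L) * t)‖ ^ 2 : ℝ) : ℂ)
      = ∑ n ∈ E, ∑ m ∈ E, (a n * (starRingEnd ℂ) (a m)) *
          (if k n - k m = 0 then ((2 * Real.pi * L : ℝ) : ℂ) else 0) := by
    rw [← intervalIntegral.integral_ofReal]
    have h2 : ∀ t : ℝ, ((‖∑ n ∈ E, a n * Complex.exp (((k n : ℂ) * Complex.I / L) * t)‖ ^ 2 : ℝ) : ℂ)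
        = ∑ n ∈ E, ∑ m ∈ E, (a n * (starRingEnd ℂ) (a m)) *
          Complex.exp ((((k n - k m : ℤ) : ℂ) * Complex.I / L) * t) := by
      intro t
      push_cast
      rw [← Complex.mul_conj', map_sum, Finset.sum_mul_sum]
      refine Finset.sum_congr rfl fun n _ => Finset.sum_congr rfl fun m _ => ?_
      rw [map_mul, ← Complex.exp_conj]
      have : (starRingEnd ℂ) (((k m : ℂ) * Complex.I / L) * t) = -(((k m : ℂ) * Complex.I / L) * t) := by
        simp [neg_div]
      rw [this, sub_mul, sub_div, sub_mul, sub_eq_add_neg, Complex.exp_add]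
      ring
    simp_rw [h2]
    rw [intervalIntegral.integral_finsetSum
      (fun n _ => Continuous.intervalIntegrable (by fun_prop) _ _)]
    refine Finset.sum_congr rfl fun n _ => ?_
    rw [intervalIntegral.integral_finsetSum
      (fun n _ => Continuous.intervalIntegrable (by fun_prop) _ _)]
    refine Finset.sum_congr rfl fun m _ => ?_
    rw [intervalIntegral.integral_const_mul, aux_int _ _ hL]
  refine (le_abs_self _).trans ?_
  rw [← Real.norm_eq_abs, ← Complex.norm_real, h1]
  have h3 : ∀ n ∈ E, ∀ m ∈ E, ‖(a n * (starRingEnd ℂ) (a m)) *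
          (if k n - k m = 0 then ((2 * Real.pi * L : ℝ) : ℂ) else 0)‖ ≤
        (Real.pi * L) * (if k n = k m then ‖a n‖ ^ 2 else 0)
        + (Real.pi * L) * (if k m = k n then ‖a m‖ ^ 2 else 0) := by
    intro n _ m _
    by_cases h : k n = k m
    · rw [if_pos (by omega), if_pos h, if_pos h.symm, norm_mul, norm_mul, RCLike.norm_conj,
        Complex.norm_real, Real.norm_of_nonneg hT]
      have : 0 ≤ Real.pi * L := by positivity
      nlinarith [mul_nonneg this (sq_nonneg (‖a n‖ - ‖a m‖))]
    · rw [if_neg (by omega), if_neg h, if_neg (Ne.symm h)]; simp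
  have h4 : ∑ n ∈ E, ∑ m ∈ E, (if k n = k m then ‖a n‖ ^ 2 else 0) ≤ 2 * ∑ n ∈ E, ‖a n‖ ^ 2 := by
    rw [Finset.mul_sum]
    refine Finset.sum_le_sum fun n hn => ?_
    rw [← Finset.sum_filter, Finset.sum_const, nsmul_eq_mul]
    have : ((E.filter (fun m => k n = k m)).card : ℝ) ≤ 2 := by exact_mod_cast hcard n hn
    gcongr
  have h5 : ∑ n ∈ E, ∑ m ∈ E, (if k m = k n then ‖a m‖ ^ 2 else 0)
      = ∑ n ∈ E, ∑ m ∈ E, (if k n = k m then ‖a n‖ ^ 2 else 0) := Finset.sum_comm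
  calc _ ≤ ∑ n ∈ E, ∑ m ∈ E, _ := (norm_sum_le _ _).trans
          (Finset.sum_le_sum fun n hn => (norm_sum_le _ _).trans
            (Finset.sum_le_sum fun m hm => h3 n hn m hm))
    _ ≤ _ := by
      simp_rw [Finset.sum_add_distrib, ← Finset.mul_sum]
      rw [h5]
      have : 0 ≤ Real.pi * L := by positivity
      nlinarith [mul_le_mul_of_nonneg_left h4 this]

theorem aux_two (p q : ℤ) (hq : q ≠ 0) (a b : Fin 2 → ℤ) (r k : ℤ)
    (ha : a 0 ^ 2 + a 1 ^ 2 = r) (hb : b 0 ^ 2 + b 1 ^ 2 = r)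
    (ka : q * a 0 + p * a 1 = k) (kb : q * b 0 + p * b 1 = k) (hab : a ≠ b) :
    (p ^ 2 + q ^ 2) * (a 1 + b 1) = 2 * k * p := by
  have hne : a 1 - b 1 ≠ 0 := by
    intro h
    apply hab
    have h1 : a 1 = b 1 := by omega
    have h0 : a 0 = b 0 := by
      apply mul_left_cancel₀ hq
      rw [h1] at ka; linarith
    funext i; fin_cases i <;> assumption
  apply mul_left_cancel₀ hne
  have e1 : q * a 0 = k - p * a 1 := by linarith
  have e2 : q * b 0 = k - p * b 1 := by linarith
  have f1 : (k - p * a 1) ^ 2 + q ^ 2 * a 1 ^ 2 = q ^ 2 * r := by rw [← e1, ← ha]; ring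
  have f2 : (k - p * b 1) ^ 2 + q ^ 2 * b 1 ^ 2 = q ^ 2 * r := by rw [← e2, ← hb]; ring
  linear_combination f1 - f2

theorem stmt3 (p q : ℤ) (hpq : Int.gcd p q = 1) (hq : q ≠ 0) :
    ∃ C : ℝ, 0 < C ∧
      ∀ (lam : ℝ), 1 ≤ lam →
        ∀ (E : Finset (Fin 2 → ℤ)),
          (∀ n : Fin 2 → ℤ, n ∈ E ↔ (∑ i, ((n i : ℝ)) ^ 2) = lam ^ 2) →
            ∀ (c : (Fin 2 → ℤ) → ℂ) (x₀ : Fin 2 → ℝ),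
              (∫ t in (0 : ℝ)..(2 * Real.pi * Real.sqrt ((p : ℝ) ^ 2 + (q : ℝ) ^ 2)),
                  ‖∑ n ∈ E, c n *
                    Complex.exp (Complex.I * (dotIR n (fun i =>
                      x₀ i + t * (![(q : ℝ), (p : ℝ)] i /
                        Real.sqrt ((p : ℝ) ^ 2 + (q : ℝ) ^ 2))) : ℂ))‖ ^ 2)
                ≤ C * ∑ n ∈ E, ‖c n‖ ^ 2 := by
  have hqr : (q : ℝ) ≠ 0 := by exact_mod_cast hq
  have hL : 0 < Real.sqrt ((p : ℝ) ^ 2 + (q : ℝ) ^ 2) := by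
    apply Real.sqrt_pos.mpr; positivity
  generalize Real.sqrt ((p : ℝ) ^ 2 + (q : ℝ) ^ 2) = L at hL ⊢
  have hL' : (L : ℂ) ≠ 0 := by exact_mod_cast hL.ne'
  refine ⟨4 * Real.pi * L, by positivity, ?_⟩
  intro lam _ E hE c x₀
  have key := aux_main E (fun n => q * n 0 + p * n 1)
    (fun n => c n * Complex.exp ((dotIR n x₀ : ℝ) * Complex.I)) L hL ?_
  · simp only [norm_mul, Complex.norm_exp_ofReal_mul_I, mul_one] at key
    refine le_trans (le_of_eq ?_) key
    congr 1
    funext t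
    congr 2
    refine Finset.sum_congr rfl fun n _ => ?_
    rw [mul_assoc, ← Complex.exp_add]
    congr 2
    simp only [dotIR, Fin.sum_univ_two, Matrix.cons_val_zero, Matrix.cons_val_one]
    push_cast
    field_simp
    ring
  · intro n hn
    by_contra hcon
    rw [not_le, Finset.two_lt_card] at hcon
    obtain ⟨x, hx, y, hy, z, hz, hxy, hxz, hyz⟩ := hcon
    have hr : ∀ m ∈ E, m 0 ^ 2 + m 1 ^ 2 = n 0 ^ 2 + n 1 ^ 2 := by
      intro m hm
      have h1 := (hE m).1 hm
      rw [← (hE n).1 hn, Fin.sum_univ_two, Fin.sum_univ_two] at h1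
      exact_mod_cast h1
    simp only [Finset.mem_filter] at hx hy hz
    have h1 := aux_two p q hq x y _ _ (hr x hx.1) (hr y hy.1) hx.2.symm hy.2.symm hxy
    have h2 := aux_two p q hq x z _ _ (hr x hx.1) (hr z hz.1) hx.2.symm hz.2.symm hxz
    have h0 : (p ^ 2 + q ^ 2) ≠ 0 := by positivity
    have h3 : y 1 = z 1 := by
      have := mul_left_cancel₀ h0 (h1.trans h2.symm)
      omega
    apply hyz
    have h4 : y 0 = z 0 := by
      apply mul_left_cancel₀ hq
      have e1 := hy.2
      have e2 := hz.2
      rw [h3] at e1; linarith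
    funext i; fin_cases i <;> assumption
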